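/- Let {V_p}_{p≥2} satisfy assumptions A1–A4 with respect to a partition of ℝ^d into cubes of side λ. Then for every p ≥ 2 and every finite configuration γ ⊂ ℝ^d, the p-body part of the energy satisfies U^(p)(γ) ≥ Σ over cubes Δ with |γ_Δ| ≥ p of |γ_Δ|^p · ( V_p^p(Δ)/p^p − p·I_p^{1|p−1} ) − p·I_p^{1|p−1} · ( Σ_{k=1}^{p−1} k^{p−1} ) · |γ|. -/

import Mathlib

open MeasureTheory
open scoped ENNReal BigOperators

noncomputable section

/-- Points of `ℝ^d`. -/
abbrev Pt (d : ℕ) := EuclideanSpace ℝ (Fin d)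

/-- The elementary cube with rib `lam` centered at the lattice point `lam • r`. -/
def cube (d : ℕ) (lam : ℝ) (r : Fin d → ℤ) : Set (Pt d) :=
  {x | ∀ i, lam * ((r i : ℝ) - 1 / 2) ≤ x i ∧ x i < lam * ((r i : ℝ) + 1 / 2)}

open scoped Classical in
/-- `|γ_Δ|`: the number of points of the finite configuration `γ` in the cube labelled `r`. -/
def occupancy (d : ℕ) (lam : ℝ) (γ : Finset (Pt d)) (r : Fin d → ℤ) : ℕ :=
  (γ.filter fun x => x ∈ cube d lam r).card

/-- Concatenate a `k`-tuple and a `(p-k)`-tuple into a `p`-tuple. -/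
def joinAt {α : Type*} (p k : ℕ) (h : k ≤ p) (y : Fin k → α) (z : Fin (p - k) → α) :
    Fin p → α :=
  fun i => Fin.append y z (Fin.cast ((Nat.add_sub_cancel' h).symm) i)

/-- The set of (ordered) pairs `i < j` in `Fin p`. -/
def pairs (p : ℕ) : Finset (Fin p × Fin p) := Finset.univ.filter fun q => q.1 < q.2

/-- `Σ_{1 ≤ i < j ≤ p} |x_i - x_j|`. -/
def pairSum (p : ℕ) (x : Fin p → ℝ) : ℝ := ∑ q ∈ pairs p, |x q.1 - x q.2|

/-- `I_p^{k_1,…,k_n}(Δ_1,…,Δ_n)`: the sup of `|V_p^-|` over choices of `k_1` points in the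
cube labelled `r 1`, …, `k_n` points in the cube labelled `r n`. -/
def IblocksT (d : ℕ) (lam : ℝ) (V : (p : ℕ) → (Fin p → Pt d) → ℝ) (p : ℕ)
    {n : ℕ} (ks : Fin n → ℕ) (r : Fin n → Fin d → ℤ) : ℝ≥0∞ :=
  ⨆ (x : Fin p → Pt d) (_ : ∃ c : Fin p → Fin n,
      (∀ i, x i ∈ cube d lam (r (c i))) ∧
      ∀ b, (Finset.univ.filter fun i => c i = b).card = ks b),
    ENNReal.ofReal |min (V p x) 0|

/-- The analogue of `IblocksT` where the number of points to be put in the cube labelled `s`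
is prescribed by the function `κ`. -/
def IblocksF (d : ℕ) (lam : ℝ) (V : (p : ℕ) → (Fin p → Pt d) → ℝ) (p : ℕ)
    (κ : (Fin d → ℤ) → ℕ) : ℝ≥0∞ :=
  ⨆ (x : Fin p → Pt d) (_ : ∃ c : Fin p → Fin d → ℤ,
      (∀ i, x i ∈ cube d lam (c i)) ∧
      ∀ s, (Finset.univ.filter fun i => c i = s).card = κ s),
    ENNReal.ofReal |min (V p x) 0|

/-- `I_p^{k|m}(Δ)`: the sum over all ordered `m`-tuples of cubes `(Δ_1,…,Δ_m)` of
`I_p^{k,1,…,1}(Δ,Δ_1,…,Δ_m)`, where `Δ` is the cube labelled `r`. -/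
def Ikm (d : ℕ) (lam : ℝ) (V : (p : ℕ) → (Fin p → Pt d) → ℝ) (p k m : ℕ)
    (r : Fin d → ℤ) : ℝ≥0∞ :=
  ∑' rs : Fin m → Fin d → ℤ,
    IblocksT d lam V p (Fin.cons k fun _ => 1) (Fin.cons r rs)

/-- `I_p^{k | {k_1,…,k_m}}(Δ)`: the sum over all unordered families of pairwise distinct
cubes, all different from `Δ`, carrying the multiset of counts `K`, of the corresponding
`I_p^{k,k_{π(1)},…,k_{π(m)}}(Δ,Δ_1,…,Δ_m)` (distinct rearrangements counted once). -/
def IpartSet (d : ℕ) (lam : ℝ) (V : (p : ℕ) → (Fin p → Pt d) → ℝ) (p : ℕ)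
    (k : ℕ) (K : Multiset ℕ) (r : Fin d → ℤ) : ℝ≥0∞ :=
  ∑' κ : {κ : (Fin d → ℤ) → ℕ //
      κ r = 0 ∧ ∃ S : Finset (Fin d → ℤ), (∀ s, κ s ≠ 0 ↔ s ∈ S) ∧ S.val.map κ = K},
    IblocksF d lam V p (Function.update (κ : (Fin d → ℤ) → ℕ) r k)

/-- `V_p^p(Δ)`: the infimum of `V_p^+` over `p`-tuples of points of the cube labelled `r`. -/
def Vpp (d : ℕ) (lam : ℝ) (V : (p : ℕ) → (Fin p → Pt d) → ℝ) (p : ℕ)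
    (r : Fin d → ℤ) : ℝ :=
  ⨅ x : {x : Fin p → Pt d // ∀ i, x i ∈ cube d lam r}, max (V p (x : Fin p → Pt d)) 0

/-- Evaluation of `V_p` on a `p`-element finite set of points (well defined for symmetric
`V_p`). -/
def evalSubset (d : ℕ) (V : (p : ℕ) → (Fin p → Pt d) → ℝ) (p : ℕ) (η : Finset (Pt d)) : ℝ :=
  if h : η.toList.length = p then V p (fun i => η.toList.get (Fin.cast h.symm i)) else 0

/-- `U^{(p)}(γ) = Σ_{{x_1,…,x_p} ⊂ γ} V_p(x_1,…,x_p)`. -/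
def pEnergy (d : ℕ) (V : (p : ℕ) → (Fin p → Pt d) → ℝ) (p : ℕ) (γ : Finset (Pt d)) : ℝ :=
  ∑ η ∈ γ.powersetCard p, evalSubset d V p η

/-- `U(γ) = Σ_{p ≥ 2} U^{(p)}(γ)`. -/
def energy (d : ℕ) (V : (p : ℕ) → (Fin p → Pt d) → ℝ) (γ : Finset (Pt d)) : ℝ :=
  ∑ p ∈ Finset.Icc 2 γ.card, pEnergy d V p γ

/-- Assumptions A1–A4 of the paper. -/
structure ManyBodyAssumptions (d : ℕ) (lam : ℝ)
    (V : (p : ℕ) → (Fin p → Pt d) → ℝ) : Prop where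
  /-- A1: symmetry. -/
  symm : ∀ p, 2 ≤ p → ∀ (x : Fin p → Pt d) (π : Equiv.Perm (Fin p)), V p (x ∘ π) = V p x
  /-- A2: translation invariance. -/
  transl : ∀ p, 2 ≤ p → ∀ (x : Fin p → Pt d) (a : Pt d), V p (fun i => x i + a) = V p x
  /-- A3: repulsion for small distances. -/
  repel : ∀ p, 2 ≤ p → ∀ (r : Fin d → ℤ) (x : Fin p → Pt d),
    (∀ i, x i ∈ cube d lam r) → 0 ≤ V p x
  /-- A4: integrability. -/
  integrable : ∀ p (hp : 2 ≤ p) k (hk1 : 1 ≤ k) (hk2 : k ≤ p - 1),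
    (⨆ y : Fin k → Pt d, ∫⁻ z : Fin (p - k) → Pt d,
      ENNReal.ofReal |min (V p (joinAt p k (by omega) y z)) 0|) < ⊤

end

theorem Nat.pow_mul_descFactorial_le {n k j : ℕ} (hkn : k ≤ n) (hjk : j ≤ k) :
    n ^ j * k.descFactorial j ≤ k ^ j * n.descFactorial j := by
  induction j with
  | zero => simp
  | succ j ih =>
    have h : n * (k - j) ≤ k * (n - j) := by
      rw [Nat.mul_sub, Nat.mul_sub, Nat.mul_comm k n]
      exact Nat.sub_le_sub_left (Nat.mul_le_mul_right j hkn) _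
    calc n ^ (j + 1) * k.descFactorial (j + 1)
        = (n * (k - j)) * (n ^ j * k.descFactorial j) := by
          rw [Nat.descFactorial_succ]; ring
      _ ≤ (k * (n - j)) * (k ^ j * n.descFactorial j) :=
          Nat.mul_le_mul h (ih (by omega))
      _ = k ^ (j + 1) * n.descFactorial (j + 1) := by
          rw [Nat.descFactorial_succ]; ring

theorem Nat.pow_le_pow_mul_choose {n k : ℕ} (hkn : k ≤ n) :
    n ^ k ≤ k ^ k * n.choose k := by
  have h := Nat.pow_mul_descFactorial_le hkn le_rfl
  rw [Nat.descFactorial_self, Nat.descFactorial_eq_factorial_mul_choose] at h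
  refine Nat.le_of_mul_le_mul_left ?_ k.factorial_pos
  calc k.factorial * n ^ k = n ^ k * k.factorial := Nat.mul_comm _ _
    _ ≤ _ := h
    _ = _ := by ring

theorem Finset.prod_le_sum_pow_card {ι : Type*} [Fintype ι] [Nonempty ι] (f : ι → ℕ) :
    ∏ i, f i ≤ ∑ i, f i ^ Fintype.card ι := by
  obtain ⟨j, hj⟩ := Finite.exists_max f
  calc ∏ i, f i ≤ ∏ _i : ι, f j := Finset.prod_le_prod' fun i _ => hj i
    _ = f j ^ Fintype.card ι := by simp
    _ ≤ _ := Finset.single_le_sum (f := fun i => f i ^ Fintype.card ι)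
        (fun _ _ => Nat.zero_le _) (Finset.mem_univ j)

/-- The label of the cube containing a given point. -/
noncomputable def cubeLabel {d : ℕ} (lam : ℝ) (x : Pt d) : Fin d → ℤ :=
  fun i => ⌊x i / lam + 1 / 2⌋

theorem mem_cube_iff_cubeLabel_eq {d : ℕ} {lam : ℝ} (hlam : 0 < lam) (x : Pt d)
    (r : Fin d → ℤ) : x ∈ cube d lam r ↔ cubeLabel lam x = r := by
  simp only [cube, Set.mem_ofPred_eq, funext_iff, cubeLabel, Int.floor_eq_iff]
  refine forall_congr' fun i => and_congr ?_ ?_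
  · rw [← sub_le_iff_le_add, le_div_iff₀ hlam, mul_comm]
  · rw [← lt_sub_iff_add_lt, div_lt_iff₀ hlam]
    ring_nf

theorem add_smul_mem_cube {d : ℕ} {lam : ℝ} {x : Pt d} {r : Fin d → ℤ} (s : Fin d → ℤ)
    (hx : x ∈ cube d lam r) :
    x + WithLp.toLp 2 (fun i => lam * (s i : ℝ)) ∈ cube d lam (r + s) := by
  intro i
  have := hx i
  simp only [PiLp.add_apply, Pi.add_apply, Int.cast_add]
  constructor <;> nlinarith [this.1, this.2]

theorem occupancy_eq_card_filter_cubeLabel {d : ℕ} {lam : ℝ} (hlam : 0 < lam)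
    (γ : Finset (Pt d)) (r : Fin d → ℤ) :
    occupancy d lam γ r = (γ.filter fun x => cubeLabel lam x = r).card := by
  simp only [occupancy, mem_cube_iff_cubeLabel_eq hlam]

/-- The supremum of `|V_p^-|` over tuples whose `i`-th point lies in the `i`-th cube. -/
noncomputable def cubeTupleSup {d : ℕ} (lam : ℝ) {p : ℕ} (W : (Fin p → Pt d) → ℝ)
    (r : Fin p → Fin d → ℤ) : ℝ≥0∞ :=
  ⨆ (x : Fin p → Pt d) (_ : ∀ i, x i ∈ cube d lam (r i)), ENNReal.ofReal |min (W x) 0|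

theorem cubeTupleSup_comp_perm_le {d : ℕ} {lam : ℝ} {p : ℕ} {W : (Fin p → Pt d) → ℝ}
    (hW : ∀ x (π : Equiv.Perm (Fin p)), W (x ∘ π) = W x) (r : Fin p → Fin d → ℤ)
    (π : Equiv.Perm (Fin p)) : cubeTupleSup lam W r ≤ cubeTupleSup lam W (r ∘ π) :=
  iSup₂_le fun x hx => by
    rw [← hW x π]
    exact le_iSup₂_of_le (x ∘ π) (fun i => hx (π i)) le_rfl

theorem cubeTupleSup_le_add_const {d : ℕ} {lam : ℝ} {p : ℕ} {W : (Fin p → Pt d) → ℝ}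
    (hW : ∀ x (a : Pt d), W (fun i => x i + a) = W x) (r : Fin p → Fin d → ℤ)
    (s : Fin d → ℤ) : cubeTupleSup lam W r ≤ cubeTupleSup lam W (fun i => r i + s) :=
  iSup₂_le fun x hx => by
    rw [← hW x (WithLp.toLp 2 (fun i => lam * (s i : ℝ)))]
    exact le_iSup₂_of_le _ (fun i => add_smul_mem_cube s (hx i)) le_rfl

theorem tsum_cubeTupleSup_cons_le_Ikm {d : ℕ} {lam : ℝ}
    {V : (p : ℕ) → (Fin p → Pt d) → ℝ} {m : ℕ}
    (hV : ∀ x (a : Pt d), V (m + 1) (fun i => x i + a) = V (m + 1) x) (r : Fin d → ℤ) :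
    ∑' s : Fin m → Fin d → ℤ, cubeTupleSup lam (V (m + 1)) (Fin.cons r s : Fin (m + 1) → _)
      ≤ Ikm d lam V (m + 1) 1 m 0 := by
  rw [Ikm, ← (Equiv.addRight (fun _ : Fin m => r)).tsum_eq]
  refine ENNReal.tsum_le_tsum fun s => (cubeTupleSup_le_add_const hV _ (-r)).trans ?_
  refine iSup₂_le fun x hx => le_iSup₂_of_le x ⟨id, fun i => ?_, fun b => ?_⟩ le_rfl
  · convert hx i using 2
    refine Fin.cases ?_ (fun j => ?_) i <;> simp
  · refine Fin.cases ?_ (fun j => ?_) b <;> simp [Finset.filter_eq']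

theorem tsum_pow_mul_cubeTupleSup_le {d : ℕ} {lam : ℝ}
    {V : (p : ℕ) → (Fin p → Pt d) → ℝ} {m : ℕ}
    (hsymm : ∀ x (π : Equiv.Perm (Fin (m + 1))), V (m + 1) (x ∘ π) = V (m + 1) x)
    (htransl : ∀ x (a : Pt d), V (m + 1) (fun i => x i + a) = V (m + 1) x)
    (N : (Fin d → ℤ) → ℝ≥0∞) (i : Fin (m + 1)) :
    ∑' r : Fin (m + 1) → Fin d → ℤ, N (r i) * cubeTupleSup lam (V (m + 1)) r
      ≤ (∑' r, N r) * Ikm d lam V (m + 1) 1 m 0 := by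
  calc ∑' r : Fin (m + 1) → Fin d → ℤ, N (r i) * cubeTupleSup lam (V (m + 1)) r
      ≤ ∑' r : Fin (m + 1) → Fin d → ℤ,
          N ((r ∘ Equiv.swap 0 i) 0) * cubeTupleSup lam (V (m + 1)) (r ∘ Equiv.swap 0 i) := by
        refine ENNReal.tsum_le_tsum fun r => ?_
        simp only [Function.comp_apply, Equiv.swap_apply_left]
        gcongr
        exact cubeTupleSup_comp_perm_le hsymm r _
    _ = ∑' r : Fin (m + 1) → Fin d → ℤ, N (r 0) * cubeTupleSup lam (V (m + 1)) r :=
        (Equiv.arrowCongr (Equiv.swap 0 i) (Equiv.refl (Fin d → ℤ))).tsum_eq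
          (fun r : Fin (m + 1) → Fin d → ℤ => N (r 0) * cubeTupleSup lam (V (m + 1)) r)
    _ = ∑' (r : Fin d → ℤ) (s : Fin m → Fin d → ℤ),
          N r * cubeTupleSup lam (V (m + 1)) (Fin.cons r s : Fin (m + 1) → _) := by
        rw [← (Fin.consEquiv fun _ : Fin (m + 1) => Fin d → ℤ).tsum_eq, ENNReal.tsum_prod']
        rfl
    _ ≤ ∑' r, N r * Ikm d lam V (m + 1) 1 m 0 := by
        refine ENNReal.tsum_le_tsum fun r => ?_
        rw [ENNReal.tsum_mul_left]
        gcongr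
        exact tsum_cubeTupleSup_cons_le_Ikm htransl r
    _ = _ := ENNReal.tsum_mul_right

theorem sum_piFinset_le_tsum_prod_card {α β : Type*} [DecidableEq β] {p : ℕ}
    (γ : Finset α) (ρ : α → β) (B : (Fin p → β) → ℝ≥0∞) :
    ∑ x ∈ Fintype.piFinset (fun _ : Fin p => γ), B (ρ ∘ x)
      ≤ ∑' r : Fin p → β, ((∏ i, (γ.filter fun x => ρ x = r i).card : ℕ) : ℝ≥0∞) * B r := by
  classical
  set T := Fintype.piFinset (fun _ : Fin p => γ)
  rw [← Finset.sum_fiberwise_of_maps_to (t := T.image (ρ ∘ ·))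
    (fun x hx => Finset.mem_image_of_mem _ hx)]
  refine le_trans (Finset.sum_le_sum fun r _ => ?_) (ENNReal.sum_le_tsum (T.image (ρ ∘ ·)))
  have hfib : (T.filter fun x => ρ ∘ x = r) =
      Fintype.piFinset fun i => γ.filter fun x => ρ x = r i := by
    ext x
    simp [T, funext_iff, forall_and]
  rw [Finset.sum_congr rfl (g := fun _ => B r)
    (fun x hx => by rw [(Finset.mem_filter.mp hx).2]), Finset.sum_const, hfib,
    Fintype.card_piFinset, nsmul_eq_mul]

theorem evalSubset_eq {d : ℕ} (V : (p : ℕ) → (Fin p → Pt d) → ℝ) {p : ℕ}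
    {η : Finset (Pt d)} (h : η.card = p) :
    ∃ x : Fin p → Pt d, Set.range x = η ∧ evalSubset d V p η = V p x := by
  have h' : η.toList.length = p := by simpa using h
  refine ⟨fun i => η.toList.get (Fin.cast h'.symm i), ?_, by simp [evalSubset, h']⟩
  subst h'
  ext y
  rw [Finset.mem_coe, ← Finset.mem_toList, List.mem_iff_get]
  rfl

theorem sum_negPart_evalSubset_le {d : ℕ} {lam : ℝ} (hlam : 0 < lam)
    {V : (p : ℕ) → (Fin p → Pt d) → ℝ} {m : ℕ}
    (hsymm : ∀ x (π : Equiv.Perm (Fin (m + 1))), V (m + 1) (x ∘ π) = V (m + 1) x)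
    (htransl : ∀ x (a : Pt d), V (m + 1) (fun i => x i + a) = V (m + 1) x)
    (γ : Finset (Pt d)) :
    ∑ η ∈ γ.powersetCard (m + 1), ENNReal.ofReal |min (evalSubset d V (m + 1) η) 0|
      ≤ ((m + 1 : ℕ) : ℝ≥0∞) * ((∑' r, (occupancy d lam γ r : ℝ≥0∞) ^ (m + 1)) *
          Ikm d lam V (m + 1) 1 m 0) := by
  classical
  have hx : ∀ η : Finset (Pt d), ∃ x : Fin (m + 1) → Pt d, η.card = m + 1 →
      Set.range x = η ∧ evalSubset d V (m + 1) η = V (m + 1) x := fun η => by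
    by_cases h : η.card = m + 1
    · obtain ⟨x, hx⟩ := evalSubset_eq V h
      exact ⟨x, fun _ => hx⟩
    · exact ⟨0, fun h' => absurd h' h⟩
  choose x hx using hx
  calc ∑ η ∈ γ.powersetCard (m + 1), ENNReal.ofReal |min (evalSubset d V (m + 1) η) 0|
      = ∑ η ∈ γ.powersetCard (m + 1), ENNReal.ofReal |min (V (m + 1) (x η)) 0| :=
        Finset.sum_congr rfl fun η hη => by
          rw [(hx η (Finset.mem_powersetCard.mp hη).2).2]
    _ = ∑ y ∈ (γ.powersetCard (m + 1)).image x, ENNReal.ofReal |min (V (m + 1) y) 0| := by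
        rw [Finset.sum_image]
        intro η hη η' hη' h
        have h1 := (hx η (Finset.mem_powersetCard.mp hη).2).1
        have h2 := (hx η' (Finset.mem_powersetCard.mp hη').2).1
        exact Finset.coe_injective (h1.symm.trans ((congrArg Set.range h).trans h2))
    _ ≤ ∑ y ∈ Fintype.piFinset (fun _ : Fin (m + 1) => γ),
          ENNReal.ofReal |min (V (m + 1) y) 0| := by
        refine Finset.sum_le_sum_of_subset fun y hy => ?_
        obtain ⟨η, hη, rfl⟩ := Finset.mem_image.mp hy
        obtain ⟨hηγ, hcard⟩ := Finset.mem_powersetCard.mp hη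
        refine Fintype.mem_piFinset.mpr fun i => hηγ ?_
        rw [← Finset.mem_coe, ← (hx η hcard).1]
        exact Set.mem_range_self i
    _ ≤ ∑ y ∈ Fintype.piFinset (fun _ : Fin (m + 1) => γ),
          cubeTupleSup lam (V (m + 1)) (cubeLabel lam ∘ y) :=
        Finset.sum_le_sum fun y _ =>
          le_iSup₂_of_le y (fun i => (mem_cube_iff_cubeLabel_eq hlam _ _).mpr rfl) le_rfl
    _ ≤ ∑' r : Fin (m + 1) → Fin d → ℤ,
          ((∏ i, occupancy d lam γ (r i) : ℕ) : ℝ≥0∞) * cubeTupleSup lam (V (m + 1)) r := by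
        simp only [occupancy_eq_card_filter_cubeLabel hlam]
        exact sum_piFinset_le_tsum_prod_card γ (cubeLabel lam) _
    _ ≤ ∑' r : Fin (m + 1) → Fin d → ℤ, ∑ i,
          (occupancy d lam γ (r i) : ℝ≥0∞) ^ (m + 1) * cubeTupleSup lam (V (m + 1)) r := by
        refine ENNReal.tsum_le_tsum fun r => ?_
        rw [← Finset.sum_mul]
        gcongr
        have := Finset.prod_le_sum_pow_card fun i => occupancy d lam γ (r i)
        rw [Fintype.card_fin] at this
        exact_mod_cast this
    _ = ∑ i, ∑' r : Fin (m + 1) → Fin d → ℤ,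
          (occupancy d lam γ (r i) : ℝ≥0∞) ^ (m + 1) * cubeTupleSup lam (V (m + 1)) r :=
        Summable.tsum_finsetSum fun _ _ => ENNReal.summable
    _ ≤ ∑ _i : Fin (m + 1), (∑' r, (occupancy d lam γ r : ℝ≥0∞) ^ (m + 1)) *
          Ikm d lam V (m + 1) 1 m 0 :=
        Finset.sum_le_sum fun i _ => tsum_pow_mul_cubeTupleSup_le hsymm htransl
          (fun r => (occupancy d lam γ r : ℝ≥0∞) ^ (m + 1)) i
    _ = _ := by simp

theorem Vpp_nonneg {d : ℕ} {lam : ℝ} (V : (p : ℕ) → (Fin p → Pt d) → ℝ) (p : ℕ)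
    (r : Fin d → ℤ) : 0 ≤ Vpp d lam V p r :=
  Real.iInf_nonneg fun _ => le_max_right _ _

theorem Vpp_le_max {d : ℕ} {lam : ℝ} (V : (p : ℕ) → (Fin p → Pt d) → ℝ) {p : ℕ}
    {r : Fin d → ℤ} {x : Fin p → Pt d} (hx : ∀ i, x i ∈ cube d lam r) :
    Vpp d lam V p r ≤ max (V p x) 0 :=
  ciInf_le (f := fun x : {x : Fin p → Pt d // ∀ i, x i ∈ cube d lam r} =>
    max (V p (x : Fin p → Pt d)) 0) ⟨0, by rintro _ ⟨_, rfl⟩; exact le_max_right _ _⟩ ⟨x, hx⟩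

theorem sum_choose_mul_Vpp_le {d : ℕ} {lam : ℝ} (hlam : 0 < lam)
    (V : (p : ℕ) → (Fin p → Pt d) → ℝ) {p : ℕ} (hp : 0 < p) (γ : Finset (Pt d)) :
    ∑ r ∈ γ.image (cubeLabel lam), ((occupancy d lam γ r).choose p : ℝ) * Vpp d lam V p r
      ≤ ∑ η ∈ γ.powersetCard p, max (evalSubset d V p η) 0 := by
  classical
  set S : (Fin d → ℤ) → Finset (Finset (Pt d)) :=
    fun r => (γ.filter fun x => cubeLabel lam x = r).powersetCard p
  have hmem : ∀ {r η}, η ∈ S r → η ⊆ γ ∧ (∀ x ∈ η, cubeLabel lam x = r) ∧ η.card = p := by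
    intro r η hη
    obtain ⟨h1, h2⟩ := Finset.mem_powersetCard.mp hη
    exact ⟨fun x hx => (Finset.mem_filter.mp (h1 hx)).1,
      fun x hx => (Finset.mem_filter.mp (h1 hx)).2, h2⟩
  have hdisj : Set.PairwiseDisjoint (γ.image (cubeLabel lam) : Set (Fin d → ℤ)) S := by
    intro r _ s _ hrs
    refine Finset.disjoint_left.mpr fun η hr hs => hrs ?_
    obtain ⟨x, hx⟩ := Finset.card_pos.mp ((hmem hr).2.2.symm ▸ hp)
    exact ((hmem hr).2.1 x hx).symm.trans ((hmem hs).2.1 x hx)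
  calc ∑ r ∈ γ.image (cubeLabel lam), ((occupancy d lam γ r).choose p : ℝ) * Vpp d lam V p r
      = ∑ r ∈ γ.image (cubeLabel lam), ∑ _η ∈ S r, Vpp d lam V p r := by
        refine Finset.sum_congr rfl fun r _ => ?_
        rw [Finset.sum_const, Finset.card_powersetCard, nsmul_eq_mul,
          occupancy_eq_card_filter_cubeLabel hlam]
    _ ≤ ∑ r ∈ γ.image (cubeLabel lam), ∑ η ∈ S r, max (evalSubset d V p η) 0 := by
        refine Finset.sum_le_sum fun r _ => Finset.sum_le_sum fun η hη => ?_
        obtain ⟨-, h1, h2⟩ := hmem hη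
        obtain ⟨x, hx, hV⟩ := evalSubset_eq V h2
        rw [hV]
        refine Vpp_le_max V fun i => (mem_cube_iff_cubeLabel_eq hlam _ _).mpr (h1 _ ?_)
        rw [← Finset.mem_coe, ← hx]
        exact Set.mem_range_self i
    _ = ∑ η ∈ (γ.image (cubeLabel lam)).biUnion S, max (evalSubset d V p η) 0 :=
        (Finset.sum_biUnion hdisj).symm
    _ ≤ _ := by
        refine Finset.sum_le_sum_of_subset_of_nonneg (fun η hη => ?_)
          fun _ _ _ => le_max_right _ _
        obtain ⟨r, -, hr⟩ := Finset.mem_biUnion.mp hη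
        exact Finset.mem_powersetCard.mpr ⟨(hmem hr).1, (hmem hr).2.2⟩

theorem occupancy_eq_zero_of_notMem_image {d : ℕ} {lam : ℝ} (hlam : 0 < lam)
    {γ : Finset (Pt d)} {r : Fin d → ℤ} (hr : r ∉ γ.image (cubeLabel lam)) :
    occupancy d lam γ r = 0 := by
  rw [occupancy_eq_card_filter_cubeLabel hlam, Finset.card_eq_zero,
    Finset.filter_eq_empty_iff]
  exact fun x hx h => hr (Finset.mem_image.mpr ⟨x, hx, h⟩)

theorem sum_choose_sub_sum_pow_le_pEnergy {d : ℕ} {lam : ℝ} (hlam : 0 < lam)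
    {V : (p : ℕ) → (Fin p → Pt d) → ℝ} {m : ℕ}
    (hsymm : ∀ x (π : Equiv.Perm (Fin (m + 1))), V (m + 1) (x ∘ π) = V (m + 1) x)
    (htransl : ∀ x (a : Pt d), V (m + 1) (fun i => x i + a) = V (m + 1) x)
    (hfin : Ikm d lam V (m + 1) 1 m 0 ≠ ⊤) (γ : Finset (Pt d)) :
    ∑ r ∈ γ.image (cubeLabel lam), (((occupancy d lam γ r).choose (m + 1) : ℝ) *
        Vpp d lam V (m + 1) r - ((m + 1 : ℕ) : ℝ) * (Ikm d lam V (m + 1) 1 m 0).toReal *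
          (occupancy d lam γ r : ℝ) ^ (m + 1))
      ≤ pEnergy d V (m + 1) γ := by
  have hneg := sum_negPart_evalSubset_le hlam hsymm htransl γ
  rw [tsum_eq_sum (s := γ.image (cubeLabel lam)) (fun r hr => by
      simp [occupancy_eq_zero_of_notMem_image hlam hr]),
    ← ENNReal.ofReal_sum_of_nonneg (fun _ _ => abs_nonneg _)] at hneg
  have hpow : ∀ r ∈ γ.image (cubeLabel lam),
      (occupancy d lam γ r : ℝ≥0∞) ^ (m + 1) ≠ ⊤ := fun r _ =>
    ENNReal.pow_ne_top (ENNReal.natCast_ne_top _)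
  have hneg' := ENNReal.toReal_mono (ENNReal.mul_ne_top (ENNReal.natCast_ne_top _)
    (ENNReal.mul_ne_top (ENNReal.sum_ne_top.mpr hpow) hfin)) hneg
  rw [ENNReal.toReal_ofReal (Finset.sum_nonneg fun _ _ => abs_nonneg _), ENNReal.toReal_mul,
    ENNReal.toReal_mul, ENNReal.toReal_sum hpow] at hneg'
  simp only [ENNReal.toReal_pow, ENNReal.toReal_natCast] at hneg'
  have hpos := sum_choose_mul_Vpp_le hlam V m.succ_pos γ
  have hsplit : pEnergy d V (m + 1) γ =
      ∑ η ∈ γ.powersetCard (m + 1), max (evalSubset d V (m + 1) η) 0 -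
        ∑ η ∈ γ.powersetCard (m + 1), |min (evalSubset d V (m + 1) η) 0| := by
    rw [pEnergy, ← Finset.sum_sub_distrib]
    refine Finset.sum_congr rfl fun η _ => ?_
    rw [abs_of_nonpos (min_le_right _ _), sub_neg_eq_add, max_add_min, add_zero]
  rw [hsplit, Finset.sum_sub_distrib, ← Finset.mul_sum]
  refine sub_le_sub hpos (hneg'.trans_eq ?_)
  ring

theorem occupancy_bound {n p : ℕ} (hp : 2 ≤ p) {v I : ℝ} (hv : 0 ≤ v) (hI : 0 ≤ I) :
    (if p ≤ n then (n : ℝ) ^ p * (v / (p : ℝ) ^ p - (p : ℝ) * I) else 0)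
        - (p : ℝ) * I * (∑ k ∈ Finset.Icc 1 (p - 1), (k : ℝ) ^ (p - 1)) * n
      ≤ (n.choose p : ℝ) * v - (p : ℝ) * I * (n : ℝ) ^ p := by
  have hpI : 0 ≤ (p : ℝ) * I := by positivity
  set K : ℝ := ∑ k ∈ Finset.Icc 1 (p - 1), (k : ℝ) ^ (p - 1)
  have hK0 : 0 ≤ K := Finset.sum_nonneg fun _ _ => by positivity
  split_ifs with h
  · have hp0 : (0 : ℝ) < (p : ℝ) ^ p := by positivity
    have hc : (n : ℝ) ^ p / (p : ℝ) ^ p ≤ n.choose p := by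
      rw [div_le_iff₀' hp0]
      exact_mod_cast Nat.pow_le_pow_mul_choose h
    have h1 := mul_le_mul_of_nonneg_right hc hv
    have h2 : 0 ≤ (p : ℝ) * I * K * n := by positivity
    have h3 : (n : ℝ) ^ p * (v / (p : ℝ) ^ p - (p : ℝ) * I) =
        (n : ℝ) ^ p / (p : ℝ) ^ p * v - (p : ℝ) * I * (n : ℝ) ^ p := by ring
    linarith
  · have hn : (n : ℝ) ^ p ≤ K * n := by
      rcases Nat.eq_zero_or_pos n with rfl | hn
      · simp [show p ≠ 0 by omega]
      · obtain ⟨m, rfl⟩ : ∃ m, p = m + 1 := ⟨p - 1, by omega⟩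
        rw [pow_succ]
        gcongr
        exact Finset.single_le_sum (f := fun k : ℕ => (k : ℝ) ^ (m + 1 - 1))
          (fun _ _ => by positivity) (Finset.mem_Icc.mpr ⟨hn, by omega⟩)
    have h1 := mul_le_mul_of_nonneg_left hn hpI
    have h2 : 0 ≤ (n.choose p : ℝ) * v := by positivity
    linarith

theorem statement10 (d : ℕ) (lam : ℝ) (hlam : 0 < lam)
    (V : (p : ℕ) → (Fin p → Pt d) → ℝ) (HA : ManyBodyAssumptions d lam V)
    (p : ℕ) (hp : 2 ≤ p) (hfin : Ikm d lam V p 1 (p - 1) 0 ≠ ⊤)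
    (γ : Finset (Pt d)) :
    (∑' r : Fin d → ℤ,
        if p ≤ occupancy d lam γ r then
          (occupancy d lam γ r : ℝ) ^ p *
            (Vpp d lam V p r / (p : ℝ) ^ p - (p : ℝ) * (Ikm d lam V p 1 (p - 1) 0).toReal)
        else 0)
      - (p : ℝ) * (Ikm d lam V p 1 (p - 1) 0).toReal *
          (∑ k ∈ Finset.Icc 1 (p - 1), (k : ℝ) ^ (p - 1)) * γ.card
    ≤ pEnergy d V p γ := by
  obtain ⟨m, rfl⟩ : ∃ m, p = m + 1 := ⟨p - 1, by omega⟩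
  have hcard : (γ.card : ℝ) = ∑ r ∈ γ.image (cubeLabel lam), (occupancy d lam γ r : ℝ) := by
    simp only [occupancy_eq_card_filter_cubeLabel hlam]
    exact_mod_cast Finset.card_eq_sum_card_image (cubeLabel lam) γ
  rw [tsum_eq_sum (s := γ.image (cubeLabel lam)) (fun r hr => by
      simp [occupancy_eq_zero_of_notMem_image hlam hr]),
    hcard, Finset.mul_sum, ← Finset.sum_sub_distrib]
  exact (Finset.sum_le_sum fun r _ => occupancy_bound hp (Vpp_nonneg V _ r)
    ENNReal.toReal_nonneg).trans
      (sum_choose_sub_sum_pow_le_pEnergy hlam (HA.symm _ hp) (HA.transl _ hp) hfin γ)
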